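/- arXiv:math/0601104 — 4 statements merged into one kernel-verified Lean document; each statement's English description precedes it below -/
import Mathlib

section
/- Let Π be a finite set, Λ ⊆ Π a subset, d : Π × Λ → ℕ a matrix, and 𝐚 : Π → ℕ a function. Call an injective map β : Λ → Π admissible if for every μ ∈ Λ one has d(β(μ), μ) = 1, and for every λ ∈ Π, d(λ, μ) ≠ 0 implies λ = β(μ) or 𝐚(β(μ)) < 𝐚(λ). If β and β' are both admissible, then β = β'; in particular the subset B = β(Λ) ⊆ Π is uniquely determined. -/
/-- Admissibility of an (injective) labelling map `β : Λ → Π`, abstracting condition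
`(Δ_a)` in the definition of a canonical basic set: `d` plays the role of the
decomposition matrix `[S^λ : D^μ]` and `aF` plays the role of Lusztig's `a`-function. -/
def IsAdmissibleLabelling {P : Type*} (Λ : Set P) (d : P → Λ → ℕ) (aF : P → ℕ)
    (β : Λ → P) : Prop :=
  Function.Injective β ∧
  (∀ μ : Λ, d (β μ) μ = 1) ∧
  (∀ (l : P) (μ : Λ), d l μ ≠ 0 → l = β μ ∨ aF (β μ) < aF l)

/-- If `β` and `β'` are both admissible labelling maps, then `β = β'`; in particular
the "canonical basic set" `B = β(Λ) ⊆ Π` is uniquely determined. -/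
theorem canonical_basic_set_unique {P : Type*} [Fintype P] (Λ : Set P)
    (d : P → Λ → ℕ) (aF : P → ℕ) (β β' : Λ → P)
    (hβ : IsAdmissibleLabelling Λ d aF β) (hβ' : IsAdmissibleLabelling Λ d aF β') :
    β = β' ∧ Set.range β = Set.range β' := by
  have h : β = β' := by
    funext μ
    obtain ⟨-, hd, hmin⟩ := hβ
    obtain ⟨-, hd', hmin'⟩ := hβ'
    rcases hmin (β' μ) μ (by simp [hd']) with heq | hlt
    · exact heq.symm
    rcases hmin' (β μ) μ (by simp [hd]) with heq' | hlt'
    · exact heq'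
    · exact absurd hlt hlt'.asymm
  exact ⟨h, congrArg Set.range h⟩
end

section
/- Fix integers a > 0 and b ≥ 0 and let λ be a bipartition of n. If N and N' are both admissible for λ, then A_N(λ) − B_N = A_{N'}(λ) − B_{N'}. Hence Lusztig's a-invariant a_λ is well defined, independent of the choice of admissible N. -/
open Finset

/-- `f : ℕ → ℕ` is the 0-indexed part function of a partition: `f i` is the part
`λ_{i+1}`; the sequence is weakly decreasing and eventually zero. -/
def IsPartitionFun (f : ℕ → ℕ) : Prop := Antitone f ∧ ∃ M, f M = 0

/-- The size `|λ|` of the partition with part function `f`. -/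
noncomputable def psize (f : ℕ → ℕ) : ℕ := ∑' i, f i

/-- `α_i = a·(λ^{(1)}_{N+r-i+1} + i - 1) + b'` for `1 ≤ i ≤ N + r`,
where `f` is the 0-indexed part function of `λ^{(1)}`. -/
def alphaE (a b' r N : ℕ) (f : ℕ → ℕ) (i : ℕ) : ℕ := a * (f (N + r - i) + (i - 1)) + b'

/-- `β_j = a·(λ^{(2)}_{N-j+1} + j - 1)` for `1 ≤ j ≤ N`,
where `g` is the 0-indexed part function of `λ^{(2)}`. -/
def betaE (a N : ℕ) (g : ℕ → ℕ) (j : ℕ) : ℕ := a * (g (N - j) + (j - 1))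

/-- `A_N(λ) = Σ_{1≤i≤N+r, 1≤j≤N} min(α_i, β_j) + Σ_{1≤i<j≤N+r} min(α_i, α_j)
    + Σ_{1≤i<j≤N} min(β_i, β_j)`. -/
def AE (a b' r N : ℕ) (f g : ℕ → ℕ) : ℕ :=
  (∑ i ∈ Icc 1 (N + r), ∑ j ∈ Icc 1 N, min (alphaE a b' r N f i) (betaE a N g j)) +
  (∑ i ∈ Icc 1 (N + r), ∑ j ∈ Icc (i + 1) (N + r),
      min (alphaE a b' r N f i) (alphaE a b' r N f j)) +
  (∑ i ∈ Icc 1 N, ∑ j ∈ Icc (i + 1) N, min (betaE a N g i) (betaE a N g j))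

/-- `B_N = Σ_{1≤i≤N+r, 1≤j≤N} min(a(i-1)+b', a(j-1))
    + Σ_{1≤i<j≤N+r} min(a(i-1)+b', a(j-1)+b') + Σ_{1≤i<j≤N} min(a(i-1), a(j-1))`. -/
def BE (a b' r N : ℕ) : ℕ :=
  (∑ i ∈ Icc 1 (N + r), ∑ j ∈ Icc 1 N, min (a * (i - 1) + b') (a * (j - 1))) +
  (∑ i ∈ Icc 1 (N + r), ∑ j ∈ Icc (i + 1) (N + r),
      min (a * (i - 1) + b') (a * (j - 1) + b')) +
  (∑ i ∈ Icc 1 N, ∑ j ∈ Icc (i + 1) N, min (a * (i - 1)) (a * (j - 1)))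

/-- `N` is admissible for the bipartition `(f | g)`:
`λ^{(1)}_{N+r+1} = 0` and `λ^{(2)}_{N+1} = 0`. -/
def AdmissibleN (r N : ℕ) (f g : ℕ → ℕ) : Prop := f (N + r) = 0 ∧ g N = 0

/-- The sum of pairwise minima of the entries of two finite sequences `x 1, …, x p` and
`y 1, …, y q`, taken together. -/
def minSum (p q : ℕ) (x y : ℕ → ℕ) : ℕ :=
  (∑ i ∈ Icc 1 p, ∑ j ∈ Icc 1 q, min (x i) (y j)) +
  (∑ i ∈ Icc 1 p, ∑ j ∈ Icc (i + 1) p, min (x i) (x j)) +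
  (∑ i ∈ Icc 1 q, ∑ j ∈ Icc (i + 1) q, min (y i) (y j))

theorem sum_Icc_succ_succ (m p : ℕ) (h : ℕ → ℕ) :
    ∑ j ∈ Icc (m + 1) (p + 1), h j = ∑ j ∈ Icc m p, h (j + 1) := by
  rw [← Finset.map_add_right_Icc m p 1, Finset.sum_map]
  rfl

theorem sum_Icc_one_succ (p : ℕ) (h : ℕ → ℕ) :
    ∑ i ∈ Icc 1 (p + 1), h i = h 1 + ∑ i ∈ Icc 1 p, h (i + 1) := by
  rw [← sum_Icc_succ_succ]
  exact (Finset.add_sum_Ioc_eq_sum_Icc (by lia)).symm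

theorem sum_pairs_min_shift (p a c : ℕ) (hc : c ≤ a) (x x' : ℕ → ℕ) (h1 : x' 1 = c)
    (hs : ∀ i ∈ Icc 1 p, x' (i + 1) = x i + a) :
    ∑ i ∈ Icc 1 (p + 1), ∑ j ∈ Icc (i + 1) (p + 1), min (x' i) (x' j) =
      (∑ i ∈ Icc 1 p, ∑ j ∈ Icc (i + 1) p, min (x i) (x j)) +
        (p * c + ∑ i ∈ Icc 1 p, ∑ _j ∈ Icc (i + 1) p, a) := by
  have first : ∑ j ∈ Icc 1 p, min c (x' (j + 1)) = p * c := by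
    rw [Finset.sum_congr rfl fun j hj => show min c (x' (j + 1)) = c by rw [hs j hj]; lia]
    simp
  have rest : ∑ i ∈ Icc 1 p, ∑ j ∈ Icc (i + 1) p, min (x' (i + 1)) (x' (j + 1)) =
      ∑ i ∈ Icc 1 p, ∑ j ∈ Icc (i + 1) p, (min (x i) (x j) + a) := by
    refine Finset.sum_congr rfl fun i hi => Finset.sum_congr rfl fun j hj => ?_
    rw [hs i hi, hs j (by simp only [mem_Icc] at hi hj ⊢; lia)]
    lia
  rw [sum_Icc_one_succ]
  simp only [sum_Icc_succ_succ, h1, first, rest, Finset.sum_add_distrib]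
  ring

theorem sum_cross_min_shift (p q a c : ℕ) (hc : c ≤ a) (x y x' y' : ℕ → ℕ)
    (hx1 : x' 1 = c) (hy1 : y' 1 = 0)
    (hx : ∀ i ∈ Icc 1 p, x' (i + 1) = x i + a) (hy : ∀ j ∈ Icc 1 q, y' (j + 1) = y j + a) :
    ∑ i ∈ Icc 1 (p + 1), ∑ j ∈ Icc 1 (q + 1), min (x' i) (y' j) =
      (∑ i ∈ Icc 1 p, ∑ j ∈ Icc 1 q, min (x i) (y j)) + (q * c + p * (q * a)) := by
  have first : ∑ j ∈ Icc 1 q, min c (y' (j + 1)) = q * c := by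
    rw [Finset.sum_congr rfl fun j hj => show min c (y' (j + 1)) = c by rw [hy j hj]; lia]
    simp
  have rest : ∑ i ∈ Icc 1 p, ∑ j ∈ Icc 1 q, min (x' (i + 1)) (y' (j + 1)) =
      ∑ i ∈ Icc 1 p, ∑ j ∈ Icc 1 q, (min (x i) (y j) + a) := by
    refine Finset.sum_congr rfl fun i hi => Finset.sum_congr rfl fun j hj => ?_
    rw [hx i hi, hy j hj]
    lia
  simp only [sum_Icc_one_succ, hx1, hy1, Nat.min_zero, zero_add, first, rest,
    Finset.sum_add_distrib, Finset.sum_const, Nat.card_Icc, smul_eq_mul, Nat.add_sub_cancel]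
  ring

/-- Shifting both sequences by `a` and prepending `c ≤ a` and `0` changes `minSum` by an amount
which depends on the lengths only. -/
theorem minSum_shift (p q a c : ℕ) (hc : c ≤ a) (x y x' y' : ℕ → ℕ)
    (hx1 : x' 1 = c) (hy1 : y' 1 = 0)
    (hx : ∀ i ∈ Icc 1 p, x' (i + 1) = x i + a) (hy : ∀ j ∈ Icc 1 q, y' (j + 1) = y j + a) :
    minSum (p + 1) (q + 1) x' y' = minSum p q x y +
      (q * c + p * (q * a) + (p * c + ∑ i ∈ Icc 1 p, ∑ _j ∈ Icc (i + 1) p, a) +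
        ∑ i ∈ Icc 1 q, ∑ _j ∈ Icc (i + 1) q, a) := by
  rw [minSum, sum_cross_min_shift p q a c hc x y x' y' hx1 hy1 hx hy,
    sum_pairs_min_shift p a c hc x x' hx1 hx,
    sum_pairs_min_shift q a 0 (Nat.zero_le a) y y' hy1 hy, minSum]
  ring

theorem AE_sub_BE_succ (a b' r N : ℕ) (hb' : b' ≤ a) (f g : ℕ → ℕ)
    (hN : AdmissibleN r N f g) :
    (AE a b' r (N + 1) f g : ℤ) - (BE a b' r (N + 1) : ℤ) =
      (AE a b' r N f g : ℤ) - (BE a b' r N : ℤ) := by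
  have hr : N + 1 + r = N + r + 1 := by ring
  have hA := minSum_shift (N + r) N a b' hb' (alphaE a b' r N f) (betaE a N g)
    (alphaE a b' r (N + 1) f) (betaE a (N + 1) g)
    (by simp [alphaE, hr, hN.1]) (by simp [betaE, hN.2])
    (fun i hi => by
      obtain ⟨k, rfl⟩ := Nat.exists_eq_add_of_le' (mem_Icc.1 hi).1
      simp only [alphaE, hr, Nat.add_sub_add_right, Nat.add_sub_cancel]
      ring)
    (fun i hi => by
      obtain ⟨k, rfl⟩ := Nat.exists_eq_add_of_le' (mem_Icc.1 hi).1
      simp only [betaE, Nat.add_sub_add_right, Nat.add_sub_cancel]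
      ring)
  have hB := minSum_shift (N + r) N a b' hb' (fun i => a * (i - 1) + b') (fun j => a * (j - 1))
    (fun i => a * (i - 1) + b') (fun j => a * (j - 1)) (by simp) (by simp)
    (fun i hi => by
      obtain ⟨k, rfl⟩ := Nat.exists_eq_add_of_le' (mem_Icc.1 hi).1
      simp only [Nat.add_sub_cancel]
      ring)
    (fun i hi => by
      obtain ⟨k, rfl⟩ := Nat.exists_eq_add_of_le' (mem_Icc.1 hi).1
      simp only [Nat.add_sub_cancel]
      ring)
  rw [← hr] at hA hB
  change AE a b' r (N + 1) f g = AE a b' r N f g + _ at hA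
  change BE a b' r (N + 1) = BE a b' r N + _ at hB
  rw [hA, hB]
  push_cast
  ring

theorem AE_sub_BE_eq_of_le (a b' r : ℕ) (hb' : b' ≤ a) (f g : ℕ → ℕ) (hf : Antitone f)
    (hg : Antitone g) {N M : ℕ} (hN : AdmissibleN r N f g) (hNM : N ≤ M) :
    (AE a b' r M f g : ℤ) - (BE a b' r M : ℤ) =
      (AE a b' r N f g : ℤ) - (BE a b' r N : ℤ) := by
  induction M, hNM using Nat.le_induction with
  | base => rfl
  | succ M hM ih =>
    refine (AE_sub_BE_succ a b' r M hb' f g ⟨?_, ?_⟩).trans ih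
    · exact Nat.le_zero.1 ((hf (by lia)).trans hN.1.le)
    · exact Nat.le_zero.1 ((hg hM).trans hN.2.le)

/-- Well-definedness of Lusztig's `a`-invariant: for a bipartition `λ = (f | g)` of `n`,
the quantity `A_N(λ) - B_N` is independent of the choice of admissible `N`. -/
theorem lusztig_a_invariant_well_defined
    (n a b r b' : ℕ) (ha : 0 < a) (hb : b = a * r + b') (hb' : b' < a)
    (f g : ℕ → ℕ) (hf : IsPartitionFun f) (hg : IsPartitionFun g)
    (hn : psize f + psize g = n)
    (N N' : ℕ) (hN : AdmissibleN r N f g) (hN' : AdmissibleN r N' f g) :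
    (AE a b' r N f g : ℤ) - (BE a b' r N : ℤ) =
      (AE a b' r N' f g : ℤ) - (BE a b' r N' : ℤ) := by
  rcases le_total N N' with h | h
  · exact (AE_sub_BE_eq_of_le a b' r hb'.le f g hf.1 hg.1 hN h).symm
  · exact AE_sub_BE_eq_of_le a b' r hb'.le f g hf.1 hg.1 hN' h
end

section
/- Fix integers a > 0 and b ≥ 0. Let λ and μ be bipartitions of n with |λ^(1)| = |μ^(1)|, |λ^(2)| = |μ^(2)|, λ^(1) ⊴ μ^(1) and λ^(2) ⊴ μ^(2). Then either λ = μ or a_μ < a_λ. -/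
open Finset

/-- Dominance order on partitions (0-indexed part functions):
`f ⊴ f'` iff `Σ_{i≤j} f_i ≤ Σ_{i≤j} f'_i` for all `j`. -/
def DominatedBy (f f' : ℕ → ℕ) : Prop :=
  ∀ m : ℕ, ∑ i ∈ range m, f i ≤ ∑ i ∈ range m, f' i

/-- The sum of `min w z` over the entries `z` of `Z`. -/
def truncSum (Z : Multiset ℤ) (w : ℤ) : ℤ := (Z.map (min w)).sum

/-- The sum of `min w z` over all ordered pairs of entries of `Z`. -/
def minEnergy (Z : Multiset ℤ) : ℤ := (Z.map (truncSum Z)).sum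

lemma truncSum_add (Z W : Multiset ℤ) (w : ℤ) :
    truncSum (Z + W) w = truncSum Z w + truncSum W w := by
  simp [truncSum]

lemma sum_truncSum_comm (Z W : Multiset ℤ) :
    (Z.map (truncSum W)).sum = (W.map (truncSum Z)).sum := by
  unfold truncSum
  rw [Multiset.sum_map_sum_map]
  simp only [min_comm]

lemma minEnergy_lt {Z W : Multiset ℤ} (h : ∀ w, truncSum W w ≤ truncSum Z w)
    (hlt : ∃ w ∈ Z, truncSum W w < truncSum Z w) : minEnergy W < minEnergy Z := by
  calc minEnergy W ≤ (W.map (truncSum Z)).sum :=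
        Multiset.sum_map_le_sum_map _ _ fun w _ => h w
    _ = (Z.map (truncSum W)).sum := sum_truncSum_comm _ _
    _ < minEnergy Z := Multiset.sum_lt_sum (fun w _ => h w) hlt

lemma truncSum_of_le {Z : Multiset ℤ} {c : ℤ} (h : ∀ z ∈ Z, c ≤ z) :
    truncSum Z c = Z.card * c := by
  unfold truncSum
  rw [Multiset.map_congr rfl fun z hz => min_eq_left (h z hz)]
  simp

lemma minEnergy_cons_of_le {Z : Multiset ℤ} {c : ℤ} (h : ∀ z ∈ Z, c ≤ z) :
    minEnergy (c ::ₘ Z) = minEnergy Z + (2 * Z.card + 1) * c := by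
  have hZ : (Z.map (truncSum (c ::ₘ Z))).sum = Z.card * c + minEnergy Z := by
    have : ∀ z ∈ Z, truncSum (c ::ₘ Z) z = c + truncSum Z z := fun z hz => by
      simp [truncSum, h z hz]
    rw [Multiset.map_congr rfl this, Multiset.sum_map_add]
    simp [minEnergy]
  have hc : truncSum (c ::ₘ Z) c = c + Z.card * c := by
    rw [← truncSum_of_le h]; simp [truncSum]
  rw [minEnergy, Multiset.map_cons, Multiset.sum_cons, hZ, hc]
  ring

lemma minEnergy_map_add (Z : Multiset ℤ) (a : ℤ) :
    minEnergy (Z.map (· + a)) = minEnergy Z + Z.card * Z.card * a := by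
  have : ∀ z, truncSum (Z.map (· + a)) (z + a) = truncSum Z z + Z.card * a := fun z => by
    simp [truncSum, min_add_add_right, Multiset.sum_map_add]
  simp only [minEnergy, Multiset.map_map, Function.comp_def, this, Multiset.sum_map_add]
  simp
  ring

lemma exists_threshold {x : ℕ → ℤ} (hx : Antitone x) (M : ℕ) (w : ℤ) :
    ∃ k ≤ M, (∀ i < k, w ≤ x i) ∧ ∀ i < M, k ≤ i → x i ≤ w := by
  induction M with
  | zero => exact ⟨0, le_rfl, by simp, by simp⟩
  | succ M ih =>
    by_cases hM : w ≤ x M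
    · exact ⟨M + 1, le_rfl, fun i hi => hM.trans (hx (by omega)), fun i hi hi' => by omega⟩
    · obtain ⟨k, hk, h1, h2⟩ := ih
      refine ⟨k, by omega, h1, fun i hi hki => ?_⟩
      rcases Nat.lt_succ_iff_lt_or_eq.mp hi with h | rfl
      · exact h2 i h hki
      · omega

lemma sum_min_add_le_of_threshold {x y : ℕ → ℤ} {M k : ℕ} {w : ℤ} (hk : k ≤ M)
    (hw : ∀ i < k, w ≤ x i) (hw' : ∀ i < M, k ≤ i → x i ≤ w)
    (htot : ∑ i ∈ range M, x i = ∑ i ∈ range M, y i) :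
    ∑ i ∈ range M, min w (y i) + (∑ i ∈ range k, y i - ∑ i ∈ range k, x i) ≤
      ∑ i ∈ range M, min w (x i) := by
  rw [← sum_range_add_sum_Ico _ hk, ← sum_range_add_sum_Ico _ hk] at htot
  rw [← sum_range_add_sum_Ico _ hk, ← sum_range_add_sum_Ico _ hk]
  have h1 : ∑ i ∈ range k, min w (y i) ≤ ∑ i ∈ range k, min w (x i) :=
    sum_le_sum fun i hi => by
      rw [min_eq_left (hw i (mem_range.mp hi))]; exact min_le_left _ _
  have h2 : ∑ i ∈ Ico k M, min w (y i) ≤ ∑ i ∈ Ico k M, y i :=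
    sum_le_sum fun i _ => min_le_right _ _
  have h3 : ∑ i ∈ Ico k M, min w (x i) = ∑ i ∈ Ico k M, x i :=
    sum_congr rfl fun i hi => by
      rw [mem_Ico] at hi; exact min_eq_right (hw' i hi.2 hi.1)
  linarith

/-- The entries `a·(λ_i + M - i) + c`, `1 ≤ i ≤ M`, in decreasing order and indexed from zero. -/
def symbolEntry (a c M : ℕ) (f : ℕ → ℕ) (i : ℕ) : ℤ := a * (f i + M - 1 - i) + c

/-- The row of the symbol given by the first `M` parts of `f`. -/
def symbolRow (a c M : ℕ) (f : ℕ → ℕ) : Multiset ℤ :=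
  (Multiset.range M).map (symbolEntry a c M f)

/-- All entries of the two-row symbol of a bipartition. -/
def symbolEntries (a b' r N : ℕ) (f g : ℕ → ℕ) : Multiset ℤ :=
  symbolRow a b' (N + r) f + symbolRow a 0 N g

lemma symbolEntry_antitone (a c M : ℕ) {f : ℕ → ℕ} (hf : Antitone f) :
    Antitone (symbolEntry a c M f) := by
  intro i j hij
  have := hf hij
  unfold symbolEntry
  gcongr

lemma truncSum_symbolRow (a c M : ℕ) (f : ℕ → ℕ) (w : ℤ) :
    truncSum (symbolRow a c M f) w = ∑ i ∈ range M, min w (symbolEntry a c M f i) := by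
  simp [truncSum, symbolRow, Finset.sum]

lemma sum_symbolEntry_sub (a c M k : ℕ) (f g : ℕ → ℕ) :
    ∑ i ∈ range k, symbolEntry a c M g i - ∑ i ∈ range k, symbolEntry a c M f i =
      a * ((∑ i ∈ range k, g i : ℕ) - (∑ i ∈ range k, f i : ℕ) : ℤ) := by
  rw [← sum_sub_distrib]
  push_cast
  rw [← sum_sub_distrib, mul_sum]
  exact sum_congr rfl fun i _ => by unfold symbolEntry; ring

lemma truncSum_symbolRow_le {a c M : ℕ} {f g : ℕ → ℕ} (hf : Antitone f)
    (hd : DominatedBy f g) (htot : ∑ i ∈ range M, f i = ∑ i ∈ range M, g i) (w : ℤ) :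
    truncSum (symbolRow a c M g) w ≤ truncSum (symbolRow a c M f) w := by
  obtain ⟨k, hk, h1, h2⟩ := exists_threshold (symbolEntry_antitone a c M hf) M w
  have htot' := sum_symbolEntry_sub a c M M f g
  rw [htot, sub_self, mul_zero] at htot'
  have h := sum_min_add_le_of_threshold hk h1 h2 (sub_eq_zero.mp htot').symm
  rw [sum_symbolEntry_sub] at h
  have : (0 : ℤ) ≤ a * ((∑ i ∈ range k, g i : ℕ) - (∑ i ∈ range k, f i : ℕ) : ℤ) :=
    mul_nonneg (by positivity) (sub_nonneg.mpr (by exact_mod_cast hd k))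
  rw [truncSum_symbolRow, truncSum_symbolRow]
  linarith

lemma exists_truncSum_symbolRow_lt {a c M : ℕ} {f g : ℕ → ℕ} (ha : 0 < a) (hf : Antitone f)
    (hd : DominatedBy f g) (htot : ∑ i ∈ range M, f i = ∑ i ∈ range M, g i)
    (hne : ∃ i < M, f i ≠ g i) :
    ∃ w ∈ symbolRow a c M f,
      truncSum (symbolRow a c M g) w < truncSum (symbolRow a c M f) w := by
  classical
  obtain ⟨hk, hfg⟩ := Nat.find_spec hne
  have hmin : ∀ i < Nat.find hne, f i = g i := fun i hi => by
    by_contra h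
    exact Nat.find_min hne hi ⟨hi.trans hk, h⟩
  set k := Nat.find hne
  have hanti := symbolEntry_antitone a c M hf
  refine ⟨symbolEntry a c M f k, Multiset.mem_map_of_mem _ (Multiset.mem_range.mpr hk), ?_⟩
  have htot' := sum_symbolEntry_sub a c M M f g
  rw [htot, sub_self, mul_zero] at htot'
  have h := sum_min_add_le_of_threshold (w := symbolEntry a c M f k) (k := k + 1) hk
    (fun i hi => hanti (by omega)) (fun i _ hi => hanti (by omega)) (sub_eq_zero.mp htot').symm
  rw [sum_symbolEntry_sub] at h
  have hlt : ∑ i ∈ range (k + 1), f i < ∑ i ∈ range (k + 1), g i := by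
    refine lt_of_le_of_ne (hd _) fun heq => hfg ?_
    have hpre : ∑ i ∈ range k, f i = ∑ i ∈ range k, g i :=
      sum_congr rfl fun i hi => hmin i (mem_range.mp hi)
    rw [sum_range_succ, sum_range_succ, hpre] at heq
    exact Nat.add_left_cancel heq
  have : (0 : ℤ) < a * ((∑ i ∈ range (k + 1), g i : ℕ) - (∑ i ∈ range (k + 1), f i : ℕ) : ℤ) :=
    mul_pos (by exact_mod_cast ha) (sub_pos.mpr (by exact_mod_cast hlt))
  rw [truncSum_symbolRow, truncSum_symbolRow]
  linarith

lemma symbolRow_succ {a c M : ℕ} {f : ℕ → ℕ} (hf : f M = 0) :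
    symbolRow a c (M + 1) f = (c : ℤ) ::ₘ (symbolRow a c M f).map (· + (a : ℤ)) := by
  rw [symbolRow, symbolRow, Multiset.range_succ, Multiset.map_cons, Multiset.map_map]
  congr 1
  · simp [symbolEntry, hf]
  · refine Multiset.map_congr rfl fun i _ => ?_
    simp only [symbolEntry, Function.comp_apply]
    push_cast
    ring

lemma card_symbolEntries (a b' r N : ℕ) (f g : ℕ → ℕ) :
    (symbolEntries a b' r N f g).card = 2 * N + r := by
  simp [symbolEntries, symbolRow]
  omega

lemma symbolRow_nonneg {a c M : ℕ} {f : ℕ → ℕ} : ∀ z ∈ symbolRow a c M f, 0 ≤ z := by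
  intro z hz
  obtain ⟨i, hi, rfl⟩ := Multiset.mem_map.mp hz
  rw [Multiset.mem_range] at hi
  have : (0 : ℤ) ≤ f i + M - 1 - i := by omega
  unfold symbolEntry
  positivity

lemma symbolEntries_succ {a b' r N : ℕ} {f g : ℕ → ℕ} (h : AdmissibleN r N f g) :
    symbolEntries a b' r (N + 1) f g =
      0 ::ₘ (b' : ℤ) ::ₘ (symbolEntries a b' r N f g).map (· + (a : ℤ)) := by
  rw [symbolEntries, symbolEntries, add_right_comm, symbolRow_succ h.1, symbolRow_succ h.2,
    Multiset.map_add, Multiset.cons_add, Multiset.add_cons, Multiset.cons_swap]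
  simp

lemma minEnergy_sub_sum_symbolEntries_succ {a b' r N : ℕ} {f g : ℕ → ℕ} (hb' : b' < a)
    (h : AdmissibleN r N f g) :
    minEnergy (symbolEntries a b' r (N + 1) f g) - (symbolEntries a b' r (N + 1) f g).sum =
      minEnergy (symbolEntries a b' r N f g) - (symbolEntries a b' r N f g).sum +
        ((2 * N + r) * (2 * N + r - 1) * a + 2 * (2 * N + r) * b') := by
  have hnn : ∀ z ∈ symbolEntries a b' r N f g, 0 ≤ z := fun z hz => by
    rcases Multiset.mem_add.mp hz with hz | hz <;> exact symbolRow_nonneg z hz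
  have hle : ∀ z ∈ (symbolEntries a b' r N f g).map (· + (a : ℤ)), (b' : ℤ) ≤ z := by
    intro z hz
    obtain ⟨y, hy, rfl⟩ := Multiset.mem_map.mp hz
    have := hnn y hy
    omega
  rw [symbolEntries_succ h, minEnergy_cons_of_le, minEnergy_cons_of_le hle, minEnergy_map_add,
    Multiset.sum_cons, Multiset.sum_cons, Multiset.sum_map_add, Multiset.card_map,
    card_symbolEntries]
  · simp [card_symbolEntries]
    ring
  · intro z hz
    rcases Multiset.mem_cons.mp hz with rfl | hz
    · positivity
    · exact (Int.natCast_nonneg b').trans (hle z hz)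

lemma sum_Icc_square_min (u : ℕ → ℤ) (M : ℕ) :
    ∑ i ∈ Icc 1 M, ∑ j ∈ Icc 1 M, min (u i) (u j) =
      2 * (∑ i ∈ Icc 1 M, ∑ j ∈ Icc (i + 1) M, min (u i) (u j)) + ∑ i ∈ Icc 1 M, u i := by
  induction M with
  | zero => simp
  | succ M ih =>
    have hin : ∀ i ∈ Icc 1 M, ∑ j ∈ Icc (i + 1) (M + 1), min (u i) (u j) =
        ∑ j ∈ Icc (i + 1) M, min (u i) (u j) + min (u i) (u (M + 1)) := fun i hi =>
      sum_Icc_succ_top (by have := (mem_Icc.mp hi).2; omega) _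
    have hsym : ∑ j ∈ Icc 1 M, min (u (M + 1)) (u j) = ∑ j ∈ Icc 1 M, min (u j) (u (M + 1)) :=
      sum_congr rfl fun _ _ => min_comm _ _
    simp only [sum_Icc_succ_top (Nat.le_add_left 1 M), sum_add_distrib, sum_congr rfl hin, ih,
      hsym]
    simp
    ring

lemma sum_map_symbolRow {a c M : ℕ} {f : ℕ → ℕ} (φ : ℤ → ℤ) :
    ((symbolRow a c M f).map φ).sum =
      ∑ i ∈ Icc 1 M, φ ((a * (f (M - i) + (i - 1)) + c : ℕ) : ℤ) := by
  rw [symbolRow, Multiset.map_map]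
  change ∑ i ∈ range M, φ (symbolEntry a c M f i) = _
  refine sum_nbij' (M - ·) (M - ·) ?_ ?_ ?_ ?_ ?_
  · intro i hi; simp at hi ⊢; omega
  · intro i hi; simp at hi ⊢; omega
  · intro i hi; simp at hi ⊢; omega
  · intro i hi; simp at hi ⊢; omega
  · intro i hi
    rw [mem_range] at hi
    have h1 : M - (M - i) = i := by omega
    have h2 : ((M - i - 1 : ℕ) : ℤ) = M - 1 - i := by omega
    rw [h1, symbolEntry]
    push_cast
    rw [h2]
    ring_nf

lemma two_mul_AE (a b' r N : ℕ) (f g : ℕ → ℕ) :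
    2 * (AE a b' r N f g : ℤ) =
      minEnergy (symbolEntries a b' r N f g) - (symbolEntries a b' r N f g).sum := by
  have hα (φ : ℤ → ℤ) : ((symbolRow a b' (N + r) f).map φ).sum =
      ∑ i ∈ Icc 1 (N + r), φ (alphaE a b' r N f i : ℤ) := sum_map_symbolRow φ
  have hβ (φ : ℤ → ℤ) : ((symbolRow a 0 N g).map φ).sum =
      ∑ i ∈ Icc 1 N, φ (betaE a N g i : ℤ) := sum_map_symbolRow φ
  have hsum : (symbolEntries a b' r N f g).sum =
      ∑ i ∈ Icc 1 (N + r), (alphaE a b' r N f i : ℤ) + ∑ i ∈ Icc 1 N, (betaE a N g i : ℤ) := by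
    rw [symbolEntries, Multiset.sum_add]
    simpa using congrArg₂ (· + ·) (hα id) (hβ id)
  have hcross : ∑ i ∈ Icc 1 N, ∑ j ∈ Icc 1 (N + r),
      min (betaE a N g i : ℤ) (alphaE a b' r N f j) =
      ∑ i ∈ Icc 1 (N + r), ∑ j ∈ Icc 1 N, min (alphaE a b' r N f i : ℤ) (betaE a N g j) := by
    rw [sum_comm]
    simp only [min_comm]
  have hen : minEnergy (symbolEntries a b' r N f g) =
      ∑ i ∈ Icc 1 (N + r), ∑ j ∈ Icc 1 (N + r),
        min (alphaE a b' r N f i : ℤ) (alphaE a b' r N f j) +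
      2 * ∑ i ∈ Icc 1 (N + r), ∑ j ∈ Icc 1 N, min (alphaE a b' r N f i : ℤ) (betaE a N g j) +
      ∑ i ∈ Icc 1 N, ∑ j ∈ Icc 1 N, min (betaE a N g i : ℤ) (betaE a N g j) := by
    simp only [minEnergy, symbolEntries, truncSum, Multiset.map_add, Multiset.sum_add, hα, hβ,
      sum_add_distrib, hcross]
    ring
  rw [hen, hsum, sum_Icc_square_min (fun i => (alphaE a b' r N f i : ℤ)),
    sum_Icc_square_min (fun i => (betaE a N g i : ℤ)), AE]
  push_cast
  ring

lemma BE_eq_AE_zero (a b' r N : ℕ) : BE a b' r N = AE a b' r N 0 0 := by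
  simp [BE, AE, alphaE, betaE]

lemma AdmissibleN.mono {r N K : ℕ} {f g : ℕ → ℕ} (hf : Antitone f) (hg : Antitone g)
    (h : AdmissibleN r N f g) (hK : N ≤ K) : AdmissibleN r K f g :=
  ⟨Nat.le_zero.mp (h.1 ▸ hf (Nat.add_le_add_right hK r)), Nat.le_zero.mp (h.2 ▸ hg hK)⟩

/-- The `a`-invariant does not depend on the choice of an admissible `N`. -/
lemma AE_sub_BE_eq {a b' r N K : ℕ} {f g : ℕ → ℕ} (hb' : b' < a) (hf : Antitone f)
    (hg : Antitone g) (h : AdmissibleN r N f g) (hK : N ≤ K) :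
    (AE a b' r K f g : ℤ) - BE a b' r K = (AE a b' r N f g : ℤ) - BE a b' r N := by
  induction K, hK using Nat.le_induction with
  | base => rfl
  | succ K hK ih =>
    have h1 := minEnergy_sub_sum_symbolEntries_succ hb' (h.mono hf hg hK)
    have h2 := minEnergy_sub_sum_symbolEntries_succ (r := r) (N := K) (f := 0) (g := 0) hb'
      ⟨rfl, rfl⟩
    simp only [← two_mul_AE, ← BE_eq_AE_zero] at h1 h2
    linarith

lemma sum_range_eq_psize {f : ℕ → ℕ} (hf : Antitone f) {M : ℕ} (hM : f M = 0) :
    ∑ i ∈ range M, f i = psize f :=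
  (tsum_eq_sum fun _ hi =>
    Nat.le_zero.mp (hM ▸ hf (not_lt.mp fun h => hi (mem_range.mpr h)))).symm

lemma exists_lt_ne {f g : ℕ → ℕ} (hf : Antitone f) (hg : Antitone g) {M : ℕ} (hfM : f M = 0)
    (hgM : g M = 0) (hne : f ≠ g) : ∃ i < M, f i ≠ g i := by
  obtain ⟨i, hi⟩ := Function.ne_iff.mp hne
  refine ⟨i, not_le.mp fun h => hi ?_, hi⟩
  have := hf h
  have := hg h
  omega

/-- Let `λ = (f₁ | g₁)` and `μ = (f₂ | g₂)` be bipartitions of `n` with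
`|λ^{(1)}| = |μ^{(1)}|`, `|λ^{(2)}| = |μ^{(2)}|`, `λ^{(1)} ⊴ μ^{(1)}` and
`λ^{(2)} ⊴ μ^{(2)}`.  Then either `λ = μ` or `a_μ < a_λ`. -/
theorem lusztig_a_invariant_componentwise_dominance
    (n a b r b' : ℕ) (ha : 0 < a) (hb : b = a * r + b') (hb' : b' < a)
    (f₁ g₁ f₂ g₂ : ℕ → ℕ)
    (hf₁ : IsPartitionFun f₁) (hg₁ : IsPartitionFun g₁)
    (hf₂ : IsPartitionFun f₂) (hg₂ : IsPartitionFun g₂)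
    (hn₁ : psize f₁ + psize g₁ = n) (hn₂ : psize f₂ + psize g₂ = n)
    (hs₁ : psize f₁ = psize f₂) (hs₂ : psize g₁ = psize g₂)
    (hd₁ : DominatedBy f₁ f₂) (hd₂ : DominatedBy g₁ g₂) :
    (f₁ = f₂ ∧ g₁ = g₂) ∨
      ∀ N N' : ℕ, AdmissibleN r N f₂ g₂ → AdmissibleN r N' f₁ g₁ →
        (AE a b' r N f₂ g₂ : ℤ) - (BE a b' r N : ℤ) <
          (AE a b' r N' f₁ g₁ : ℤ) - (BE a b' r N' : ℤ) := by
  by_cases heq : f₁ = f₂ ∧ g₁ = g₂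
  · exact Or.inl heq
  refine Or.inr fun N N' h₂ h₁ => ?_
  set K := max N N'
  rw [← AE_sub_BE_eq hb' hf₂.1 hg₂.1 h₂ (le_max_left N N'),
    ← AE_sub_BE_eq hb' hf₁.1 hg₁.1 h₁ (le_max_right N N')]
  have hK₂ := h₂.mono hf₂.1 hg₂.1 (le_max_left N N')
  have hK₁ := h₁.mono hf₁.1 hg₁.1 (le_max_right N N')
  have htf : ∑ i ∈ range (K + r), f₁ i = ∑ i ∈ range (K + r), f₂ i := by
    rw [sum_range_eq_psize hf₁.1 hK₁.1, sum_range_eq_psize hf₂.1 hK₂.1, hs₁]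
  have htg : ∑ i ∈ range K, g₁ i = ∑ i ∈ range K, g₂ i := by
    rw [sum_range_eq_psize hg₁.1 hK₁.2, sum_range_eq_psize hg₂.1 hK₂.2, hs₂]
  have hlef := truncSum_symbolRow_le (a := a) (c := b') hf₁.1 hd₁ htf
  have hleg := truncSum_symbolRow_le (a := a) (c := 0) hg₁.1 hd₂ htg
  have hlt : minEnergy (symbolEntries a b' r K f₂ g₂) <
      minEnergy (symbolEntries a b' r K f₁ g₁) := by
    refine minEnergy_lt (fun w => ?_) ?_
    · rw [symbolEntries, symbolEntries, truncSum_add, truncSum_add]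
      exact add_le_add (hlef w) (hleg w)
    · simp only [symbolEntries, truncSum_add, Multiset.mem_add]
      rcases not_and_or.mp heq with hne | hne
      · obtain ⟨w, hw, hlt⟩ := exists_truncSum_symbolRow_lt (c := b') ha hf₁.1 hd₁ htf
          (exists_lt_ne hf₁.1 hf₂.1 hK₁.1 hK₂.1 hne)
        exact ⟨w, Or.inl hw, add_lt_add_of_lt_of_le hlt (hleg w)⟩
      · obtain ⟨w, hw, hlt⟩ := exists_truncSum_symbolRow_lt (c := 0) ha hg₁.1 hd₂ htg
          (exists_lt_ne hg₁.1 hg₂.1 hK₁.2 hK₂.2 hne)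
        exact ⟨w, Or.inr hw, add_lt_add_of_le_of_lt (hlef w) hlt⟩
  have hsum : (symbolEntries a b' r K f₁ g₁).sum = (symbolEntries a b' r K f₂ g₂).sum := by
    have hf := sum_symbolEntry_sub a b' (K + r) (K + r) f₁ f₂
    have hg := sum_symbolEntry_sub a 0 K K g₁ g₂
    rw [htf, sub_self, mul_zero, sub_eq_zero] at hf
    rw [htg, sub_self, mul_zero, sub_eq_zero] at hg
    rw [symbolEntries, symbolEntries, Multiset.sum_add, Multiset.sum_add]
    exact (congrArg₂ (· + ·) hf hg).symm
  have := two_mul_AE a b' r K f₁ g₁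
  have := two_mul_AE a b' r K f₂ g₂
  linarith
end

section
/- Fix integers a, b with b > (n−1)a > 0. If λ and μ are bipartitions of n with λ ⊴ μ in the dominance order on bipartitions, then either λ = μ or a_μ < a_λ, where a_λ := b·|λ^(2)| + a·(n(λ^(1)) + 2·n(λ^(2)) − n(λ^(2)*)). -/
open Finset

/-- `n(ν) = Σ_{i≥1} (i-1)·ν_i` for the partition with 0-indexed part function `f`. -/
noncomputable def nFn (f : ℕ → ℕ) : ℕ := ∑' i, i * f i

/-- The 0-indexed part function of the conjugate partition: `ν*_{i+1} = #{j : ν_j ≥ i+1}`. -/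
noncomputable def conjFn (f : ℕ → ℕ) (i : ℕ) : ℕ := Set.ncard {j : ℕ | i + 1 ≤ f j}

/-- The closed formula for Lusztig's `a`-invariant of the bipartition `(f | g)` when
`b > (n-1)·a > 0`:  `a_λ = b·|λ^{(2)}| + a·(n(λ^{(1)}) + 2·n(λ^{(2)}) - n(λ^{(2)*}))`. -/
noncomputable def aInv (a b : ℕ) (f g : ℕ → ℕ) : ℤ :=
  (b : ℤ) * (psize g : ℤ) +
    (a : ℤ) * ((nFn f : ℤ) + 2 * (nFn g : ℤ) - (nFn (conjFn g) : ℤ))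

/-- Dominance order on bipartitions: `(f₁|g₁) ⊴ (f₂|g₂)` iff
`Σ_{i≤j} f₁_i ≤ Σ_{i≤j} f₂_i` for all `j`, and
`|f₁| + Σ_{i≤j} g₁_i ≤ |f₂| + Σ_{i≤j} g₂_i` for all `j`. -/
def BipDominatedBy (f₁ g₁ f₂ g₂ : ℕ → ℕ) : Prop :=
  (∀ m : ℕ, ∑ i ∈ range m, f₁ i ≤ ∑ i ∈ range m, f₂ i) ∧
  (∀ m : ℕ, psize f₁ + ∑ i ∈ range m, g₁ i ≤ psize f₂ + ∑ i ∈ range m, g₂ i)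

theorem IsPartitionFun.exists_forall_ge_eq_zero {f : ℕ → ℕ} (hf : IsPartitionFun f) :
    ∃ M, ∀ i, M ≤ i → f i = 0 := by
  obtain ⟨ha, M, hM⟩ := hf
  exact ⟨M, fun i hi => by have := ha hi; omega⟩

theorem psize_eq_sum_range {f : ℕ → ℕ} {N : ℕ} (hN : ∀ i, N ≤ i → f i = 0) :
    psize f = ∑ i ∈ range N, f i :=
  tsum_eq_sum fun i hi => hN i (by simpa using hi)

theorem nFn_eq_sum_range {f : ℕ → ℕ} {N : ℕ} (hN : ∀ i, N ≤ i → f i = 0) :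
    nFn f = ∑ i ∈ range N, i * f i :=
  tsum_eq_sum fun i hi => by rw [hN i (by simpa using hi), mul_zero]

theorem conjFn_eq_card_filter {f : ℕ → ℕ} {N : ℕ} (hN : ∀ i, N ≤ i → f i = 0) (i : ℕ) :
    conjFn f i = #{j ∈ range N | i < f j} := by
  rw [conjFn, ← Set.ncard_coe_finset]
  congr 1
  ext j
  have := hN j
  simp only [Set.mem_ofPred_eq, coe_filter, mem_range]
  omega

/-- `2 n(ν*) = Σ ν_i (ν_i - 1)`. -/
theorem two_mul_nFn_conjFn {f : ℕ → ℕ} (hf : Antitone f) {N : ℕ}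
    (hN : ∀ i, N ≤ i → f i = 0) :
    2 * (nFn (conjFn f) : ℤ) = ∑ i ∈ range N, (f i : ℤ) * (f i - 1) := by
  have hzero : ∀ i, f 0 ≤ i → conjFn f i = 0 := by
    intro i hi
    rw [conjFn_eq_card_filter hN, card_eq_zero, filter_eq_empty_iff]
    intro j _
    have := hf (Nat.zero_le j)
    omega
  have hswap : nFn (conjFn f) = ∑ j ∈ range N, ∑ i ∈ range (f j), i := by
    rw [nFn_eq_sum_range hzero]
    calc ∑ i ∈ range (f 0), i * conjFn f i
        = ∑ i ∈ range (f 0), ∑ j ∈ range N, if i < f j then i else 0 := by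
          refine sum_congr rfl fun i _ => ?_
          rw [conjFn_eq_card_filter hN, ← sum_filter, sum_const, smul_eq_mul, mul_comm]
      _ = ∑ j ∈ range N, ∑ i ∈ range (f 0), if i < f j then i else 0 := sum_comm
      _ = ∑ j ∈ range N, ∑ i ∈ range (f j), i := by
          refine sum_congr rfl fun j _ => ?_
          rw [← sum_filter]
          refine sum_congr ?_ fun _ _ => rfl
          ext i
          have := hf (Nat.zero_le j)
          simp only [mem_filter, mem_range]
          omega
  rw [hswap, Nat.cast_sum, mul_sum]
  refine sum_congr rfl fun j _ => ?_
  have h := sum_range_id_mul_two (f j)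
  rcases Nat.eq_zero_or_pos (f j) with h0 | hpos
  · simp [h0]
  · rw [mul_comm]
    have h' : ((∑ i ∈ range (f j), i : ℕ) : ℤ) * 2 = ((f j * (f j - 1) : ℕ) : ℤ) := by
      exact_mod_cast h
    rw [h', Nat.cast_mul, Nat.cast_sub hpos, Nat.cast_one]

theorem sum_range_mul_nonneg_of_antitone {w e : ℕ → ℤ} (hw : Antitone w) (hw0 : ∀ i, 0 ≤ w i)
    (he : ∀ m, 0 ≤ ∑ i ∈ range m, e i) (N : ℕ) : 0 ≤ ∑ i ∈ range N, w i * e i := by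
  have key : ∀ m, w m * ∑ i ∈ range m, e i ≤ ∑ i ∈ range m, w i * e i := by
    intro m
    induction m with
    | zero => simp
    | succ m ih =>
      have h1 := mul_le_mul_of_nonneg_right (hw (Nat.le_succ m)) (he (m + 1))
      rw [Nat.succ_eq_add_one] at h1
      refine h1.trans ?_
      rw [sum_range_succ, sum_range_succ, mul_add]
      linarith
  exact (mul_nonneg (hw0 N) (he N)).trans (key N)

/-- Weighted sum of `i * u i` by summation by parts. -/
theorem sum_range_mul_add_sum_partial_sums (u : ℕ → ℕ) (N : ℕ) :
    ∑ i ∈ range N, i * u i + ∑ m ∈ range N, ∑ i ∈ range (m + 1), u i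
      = N * ∑ i ∈ range N, u i := by
  induction N with
  | zero => simp
  | succ N ih =>
    rw [sum_range_succ (fun i => i * u i), sum_range_succ (fun m => ∑ i ∈ range (m + 1), u i),
      sum_range_succ u N]
    linarith

theorem nFn_eq_sum_tails {f : ℕ → ℕ} {N : ℕ} (hN : ∀ i, N ≤ i → f i = 0) :
    (nFn f : ℤ) = ∑ m ∈ range N, ((psize f : ℤ) - ∑ i ∈ range (m + 1), (f i : ℤ)) := by
  have h := sum_range_mul_add_sum_partial_sums f N
  rw [← nFn_eq_sum_range hN, ← psize_eq_sum_range hN] at h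
  rw [sum_sub_distrib, sum_const, card_range, nsmul_eq_mul]
  have h' := congrArg (Nat.cast : ℕ → ℤ) h
  push_cast at h'
  linarith

theorem nFn_le_of_tail_le {f g : ℕ → ℕ} {N : ℕ} (hf : ∀ i, N ≤ i → f i = 0)
    (hg : ∀ i, N ≤ i → g i = 0)
    (h : ∀ m, (psize g : ℤ) - ∑ i ∈ range m, (g i : ℤ) ≤ psize f - ∑ i ∈ range m, (f i : ℤ)) :
    nFn g ≤ nFn f := by
  zify
  rw [nFn_eq_sum_tails hf, nFn_eq_sum_tails hg]
  exact sum_le_sum fun m _ => h (m + 1)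

/-- `n(ν)` is strictly antitone for the dominance order on partitions of a fixed size. -/
theorem eq_or_nFn_lt_of_dominated {f g : ℕ → ℕ} {N : ℕ} (hf : ∀ i, N ≤ i → f i = 0)
    (hg : ∀ i, N ≤ i → g i = 0) (hsize : psize f = psize g)
    (h : ∀ m, ∑ i ∈ range m, f i ≤ ∑ i ∈ range m, g i) : f = g ∨ nFn g < nFn f := by
  by_cases hlt : ∃ m ∈ range N, ∑ i ∈ range (m + 1), f i < ∑ i ∈ range (m + 1), g i
  · right
    zify
    rw [nFn_eq_sum_tails hf, nFn_eq_sum_tails hg, hsize]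
    obtain ⟨m, hm, hlt⟩ := hlt
    refine sum_lt_sum (fun k _ => ?_) ⟨m, hm, ?_⟩
    · have := h (k + 1)
      zify at this
      linarith
    · zify at hlt
      linarith
  · left
    push Not at hlt
    have heq : ∀ m, m ≤ N → ∑ i ∈ range m, f i = ∑ i ∈ range m, g i := by
      intro m hm
      cases m with
      | zero => simp
      | succ m => exact le_antisymm (h _) (hlt m (by simpa using hm))
    funext m
    by_cases hm : m < N
    · have h1 := heq (m + 1) hm
      rw [sum_range_succ, sum_range_succ, heq m hm.le] at h1
      omega
    · rw [hf m (by omega), hg m (by omega)]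

theorem two_mul_sum_range_sub_le (d N : ℕ) :
    2 * ∑ m ∈ range N, ((d - (m + 1) : ℕ) : ℤ) ≤ d * (d - 1) := by
  induction d generalizing N with
  | zero => simp
  | succ d ih =>
    cases N with
    | zero => simp
    | succ N =>
      rw [sum_range_succ']
      have h := ih N
      have h2 : ∀ m, d + 1 - (m + 1 + 1) = d - (m + 1) := fun m => by omega
      simp only [h2]
      simp only [zero_add, Nat.add_sub_cancel]
      push_cast
      linarith

theorem two_mul_sum_range_min_sub_le (d s N : ℕ) :
    2 * ∑ m ∈ range N, ((min d (s + d - (m + 1)) : ℕ) : ℤ) ≤ 2 * d * s + d * (d - 1) := by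
  induction s generalizing N with
  | zero =>
    have h := two_mul_sum_range_sub_le d N
    have h2 : ∀ m, min d (0 + d - (m + 1)) = d - (m + 1) := fun m => by omega
    simp only [h2]
    simpa using h
  | succ s ih =>
    cases N with
    | zero =>
      have h := ih 0
      simp only [range_zero, sum_empty] at h ⊢
      push_cast
      nlinarith
    | succ N =>
      rw [sum_range_succ']
      have h := ih N
      have h2 : ∀ m, s + 1 + d - (m + 1 + 1) = s + d - (m + 1) := fun m => by omega
      have h3 : min d (s + 1 + d - (0 + 1)) = d := by omega
      simp only [h2, h3]
      push_cast at h ⊢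
      linarith

theorem Antitone.le_sum_range_or_sum_range_eq_psize {f : ℕ → ℕ} (hf : Antitone f) (m : ℕ) :
    m ≤ ∑ i ∈ range m, f i ∨ ∑ i ∈ range m, f i = psize f := by
  rcases Nat.eq_zero_or_pos (f m) with h0 | hpos
  · right
    exact (psize_eq_sum_range fun i hi => by have := hf hi; omega).symm
  · left
    calc m = ∑ i ∈ range m, 1 := by simp
      _ ≤ ∑ i ∈ range m, f i := sum_le_sum fun i hi =>
          hpos.trans_le (hf (mem_range.mp hi).le)

theorem sum_range_le_psize {f : ℕ → ℕ} {N : ℕ} (hN : ∀ i, N ≤ i → f i = 0) (m : ℕ) :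
    ∑ i ∈ range m, f i ≤ psize f := by
  rw [psize_eq_sum_range (N := max N m) fun i hi => hN i (le_of_max_le_left hi)]
  exact sum_le_sum_of_subset (range_mono (le_max_right N m))

/-- If `f` is dominated by a partition `g` of size `|f| + d`, then
`n(g) ≤ n(f) + d|f| + d(d-1)/2`. -/
theorem two_mul_nFn_le_of_dominated {f g : ℕ → ℕ} {N d : ℕ} (hg : Antitone g)
    (hfN : ∀ i, N ≤ i → f i = 0) (hgN : ∀ i, N ≤ i → g i = 0) (hsize : psize g = psize f + d)
    (h : ∀ m, ∑ i ∈ range m, f i ≤ ∑ i ∈ range m, g i) :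
    2 * (nFn g : ℤ) ≤ 2 * nFn f + 2 * d * psize f + d * (d - 1) := by
  have hsum := two_mul_sum_range_min_sub_le d (psize f) N
  have hle : (nFn g : ℤ) - nFn f
      ≤ ∑ m ∈ range N, ((min d (psize f + d - (m + 1)) : ℕ) : ℤ) := by
    rw [nFn_eq_sum_tails hfN, nFn_eq_sum_tails hgN, ← sum_sub_distrib]
    refine sum_le_sum fun m _ => ?_
    have h1 := h (m + 1)
    have h2 := sum_range_le_psize hfN (m + 1)
    have h3 := hg.le_sum_range_or_sum_range_eq_psize (m + 1)
    rw [← Nat.cast_sum, ← Nat.cast_sum]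
    omega
  linarith

/-- If the partial sums of a partition `f` exceed those of `g` by at most `d`, then
`n(f*) ≤ n(g*) + d g_1 + d(d-1)/2`. -/
theorem two_mul_nFn_conjFn_le {f g : ℕ → ℕ} {N d : ℕ} (hf : Antitone f) (hg : Antitone g)
    (hfN : ∀ i, N ≤ i → f i = 0) (hgN : ∀ i, N ≤ i → g i = 0)
    (h : ∀ m, ∑ i ∈ range m, f i ≤ d + ∑ i ∈ range m, g i) :
    2 * (nFn (conjFn f) : ℤ) ≤ 2 * nFn (conjFn g) + 2 * d * g 0 + d * (d - 1) := by
  have hfN' : ∀ i, N + 1 ≤ i → f i = 0 := fun i hi => hfN i (by omega)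
  have hgN' : ∀ i, N + 1 ≤ i → g i = 0 := fun i hi => hgN i (by omega)
  set y : ℕ → ℤ := fun i => g i + if i = 0 then (d : ℤ) else 0 with hy
  have hpartial : ∀ m, 0 ≤ ∑ i ∈ range m, (y i - f i) := by
    intro m
    cases m with
    | zero => simp
    | succ m =>
      have h1 := h (m + 1)
      zify at h1
      simp only [hy, sum_sub_distrib, sum_add_distrib, sum_ite_eq', mem_range, Nat.succ_pos,
        if_true]
      linarith
  have habel := sum_range_mul_nonneg_of_antitone (w := fun i => (f i : ℤ))
    (fun i j hij => Int.ofNat_le.mpr (hf hij)) (fun i => by positivity) hpartial (N + 1)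
  have hconv : ∑ i ∈ range (N + 1), (f i : ℤ) * (f i - 1) +
      2 * ∑ i ∈ range (N + 1), (f i : ℤ) * (y i - f i) ≤
      ∑ i ∈ range (N + 1), y i * (y i - 1) := by
    rw [mul_sum, ← sum_add_distrib]
    refine sum_le_sum fun i _ => ?_
    have ht : 0 ≤ (y i - f i) * (y i - f i - 1) := by
      rcases le_or_gt (y i - f i) 0 with h0 | h0
      · exact mul_nonneg_of_nonpos_of_nonpos h0 (by linarith)
      · exact mul_nonneg h0.le (by linarith [Int.add_one_le_iff.mpr h0])
    linarith
  have hysum : ∑ i ∈ range (N + 1), y i * (y i - 1) =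
      ∑ i ∈ range (N + 1), (g i : ℤ) * (g i - 1) + (2 * d * g 0 + d * (d - 1)) := by
    rw [sum_range_succ', sum_range_succ' (fun i => (g i : ℤ) * (g i - 1))]
    simp only [hy, Nat.succ_ne_zero, if_false, if_true, add_zero]
    ring
  rw [two_mul_nFn_conjFn hf hfN', two_mul_nFn_conjFn hg hgN']
  linarith

/-- Fix `b > (n-1)·a > 0`.  If `λ = (f₁|g₁)` and `μ = (f₂|g₂)` are bipartitions of `n`
with `λ ⊴ μ` in the dominance order on bipartitions, then either `λ = μ` or
`a_μ < a_λ`. -/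
theorem a_invariant_strict_decrease_along_dominance
    (n a b : ℕ) (hna : 0 < (n - 1) * a) (hab : (n - 1) * a < b)
    (f₁ g₁ f₂ g₂ : ℕ → ℕ)
    (hf₁ : IsPartitionFun f₁) (hg₁ : IsPartitionFun g₁)
    (hf₂ : IsPartitionFun f₂) (hg₂ : IsPartitionFun g₂)
    (hn₁ : psize f₁ + psize g₁ = n) (hn₂ : psize f₂ + psize g₂ = n)
    (hdom : BipDominatedBy f₁ g₁ f₂ g₂) :
    (f₁ = f₂ ∧ g₁ = g₂) ∨ aInv a b f₂ g₂ < aInv a b f₁ g₁ := by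
  obtain ⟨M₁, hM₁⟩ := hf₁.exists_forall_ge_eq_zero
  obtain ⟨M₂, hM₂⟩ := hg₁.exists_forall_ge_eq_zero
  obtain ⟨M₃, hM₃⟩ := hf₂.exists_forall_ge_eq_zero
  obtain ⟨M₄, hM₄⟩ := hg₂.exists_forall_ge_eq_zero
  obtain ⟨N, hN⟩ : ∃ N, N = M₁ + M₂ + M₃ + M₄ := ⟨_, rfl⟩
  replace hM₁ : ∀ i, N ≤ i → f₁ i = 0 := fun i hi => hM₁ i (by omega)
  replace hM₂ : ∀ i, N ≤ i → g₁ i = 0 := fun i hi => hM₂ i (by omega)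
  replace hM₃ : ∀ i, N ≤ i → f₂ i = 0 := fun i hi => hM₃ i (by omega)
  replace hM₄ : ∀ i, N ≤ i → g₂ i = 0 := fun i hi => hM₄ i (by omega)
  obtain ⟨hdf, hdg⟩ := hdom
  obtain ⟨d, hd⟩ : ∃ d, psize f₂ = psize f₁ + d := by
    apply Nat.exists_eq_add_of_le
    rw [psize_eq_sum_range hM₁, psize_eq_sum_range hM₃]
    exact hdf N
  have hf := two_mul_nFn_le_of_dominated hf₂.1 hM₁ hM₃ hd hdf
  have hconj := two_mul_nFn_conjFn_le (d := d) hg₁.1 hg₂.1 hM₂ hM₄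
    fun m => by have := hdg m; omega
  have hg : nFn g₂ ≤ nFn g₁ := nFn_le_of_tail_le hM₂ hM₄ fun m => by
    have := hdg m
    rw [← Nat.cast_sum, ← Nat.cast_sum]
    omega
  have ha : (0 : ℤ) < a := by exact_mod_cast Nat.pos_of_mul_pos_left hna
  zify at hg
  unfold aInv
  rcases Nat.eq_zero_or_pos d with rfl | hdpos
  · have hsg : psize g₁ = psize g₂ := by omega
    simp only [Nat.cast_zero, mul_zero, zero_mul, add_zero] at hf hconj
    have hcase := eq_or_nFn_lt_of_dominated hM₁ hM₃ (by omega) hdf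
    have hcase' := eq_or_nFn_lt_of_dominated hM₂ hM₄ hsg fun m => by have := hdg m; omega
    by_cases heq : f₁ = f₂ ∧ g₁ = g₂
    · exact Or.inl heq
    · right
      rw [hsg]
      refine (add_lt_add_iff_left _).mpr (mul_lt_mul_of_pos_left ?_ ha)
      have hlt : nFn f₂ < nFn f₁ ∨ nFn g₂ < nFn g₁ := by tauto
      omega
  · right
    have hg0 : g₂ 0 ≤ psize g₂ := by simpa using sum_range_le_psize hM₄ 1
    have hcoef : ((psize f₁ + d : ℕ) : ℤ) + g₂ 0 ≤ n := by exact_mod_cast (by omega)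
    have hd0 : (0 : ℤ) < d := by exact_mod_cast hdpos
    have hb : ((n : ℤ) - 1) * a < b := by
      have h : (((n - 1 : ℕ) * a : ℕ) : ℤ) < b := by exact_mod_cast hab
      rwa [Nat.cast_mul, Nat.cast_sub (by omega), Nat.cast_one] at h
    have hsg : (psize g₁ : ℤ) = psize g₂ + d := by exact_mod_cast (by omega)
    have hdiff : ((nFn f₂ : ℤ) + 2 * nFn g₂ - nFn (conjFn g₂)) -
        (nFn f₁ + 2 * nFn g₁ - nFn (conjFn g₁)) ≤ d * (n - 1) := by
      have h := mul_le_mul_of_nonneg_left hcoef hd0.le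
      push_cast at h
      linarith
    have h1 := mul_le_mul_of_nonneg_left hdiff ha.le
    have h2 := mul_lt_mul_of_pos_right hb hd0
    rw [hsg]
    linarith
end
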